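/- arXiv:1907.01438 — 2 statements merged into one kernel-verified Lean document; each statement's English description precedes it below -/
import Mathlib

section
/- Let c ≠ 0 be real, let p : ℝ → ℝ be continuous, and let f : ℝ → ℝ be a lift of a circle diffeomorphism (in particular f is a smooth bijection of ℝ). Define q : ℝ → ℝ by q(f(x)) = (p(x) + (c/12)·S[f](x)) / f'(x)² for all x ∈ ℝ, where S[f] is the Schwarzian derivative of f. If ψ : ℝ → ℝ is twice differentiable and solves −(c/6)ψ''(x) + p(x)ψ(x) = 0 for all x, then the function φ : ℝ → ℝ determined by φ(f(x)) = √(f'(x))·ψ(x) is twice differentiable and solves −(c/6)φ''(y) + q(y)φ(y) = 0 for all y ∈ ℝ. (Solutions of Hill's equation transform as densities of weight −1/2 under the Virasoro coadjoint action.) -/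
open Real

/-- The Schwarzian derivative `S[f] = f'''/f' - (3/2)(f''/f')²`. -/
noncomputable def schwarzian (f : ℝ → ℝ) (x : ℝ) : ℝ :=
  deriv (deriv (deriv f)) x / deriv f x - 3 / 2 * (deriv (deriv f) x / deriv f x) ^ 2

/-- A continuous monotone map commuting with translation by a positive period is surjective. -/
theorem surjective_of_map_add_period {f : ℝ → ℝ} (hc : Continuous f) (hm : Monotone f)
    {T : ℝ} (hT : 0 < T) (h : ∀ x, f (x + T) = f x + T) : Function.Surjective f := by
  have hper : Function.Periodic (fun x => f x - x) T := fun x => by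
    simp only [h]; ring
  have hint : ∀ n : ℤ, f (n * T) = f 0 + n * T := fun n => by
    have := hper.int_mul n 0
    simp only [zero_add] at this
    linarith
  refine hc.surjective (Filter.tendsto_atTop_atTop_of_monotone hm fun b => ?_)
    (Filter.tendsto_atBot_atBot_of_monotone hm fun b => ?_)
  · refine ⟨⌈(b - f 0) / T⌉ * T, ?_⟩
    have := (div_le_iff₀ hT).1 (Int.le_ceil ((b - f 0) / T))
    rw [hint]; linarith
  · refine ⟨⌊(b - f 0) / T⌋ * T, ?_⟩
    have := (le_div_iff₀ hT).1 (Int.floor_le ((b - f 0) / T))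
    rw [hint]; linarith

/-- Differentiability of `g ∘ f` descends to `g` when `f` is an increasing bijection of `ℝ`
with nonvanishing derivative. -/
theorem HasDerivAt.of_comp_strictMono {f g : ℝ → ℝ} (hm : StrictMono f)
    (hs : Function.Surjective f) {x f' d : ℝ} (hf : HasDerivAt f f' x) (hf' : f' ≠ 0)
    (h : HasDerivAt (fun t => g (f t)) d x) : HasDerivAt g (d / f') (f x) := by
  let e := hm.orderIsoOfSurjective f hs
  have hx : e.symm (f x) = x := e.symm_apply_apply x
  have hright : ∀ y, f (e.symm y) = y := e.apply_symm_apply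
  have hinv : HasDerivAt e.symm f'⁻¹ (f x) :=
    HasDerivAt.of_local_left_inverse (f := f) e.symm.continuous.continuousAt
      (by rwa [hx]) hf' (Filter.Eventually.of_forall hright)
  have hcomp := HasDerivAt.comp (h₂ := fun t => g (f t)) (f x) (by rwa [hx]) hinv
  have heq : (fun t => g (f t)) ∘ e.symm = g := funext fun y => congrArg g (hright y)
  rwa [heq, ← div_eq_mul_inv] at hcomp

/-- **Solutions of Hill's equation transform as densities of weight `-1/2`.**
If `f` is a lift of a circle diffeomorphism, `q` is the Virasoro coadjoint transform of
the potential `p` under `f`, and `ψ` is a twice differentiable solution of Hill's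
equation for `p`, then the function `φ` determined by `φ(f(x)) = √(f'(x)) ψ(x)` is
twice differentiable and solves Hill's equation for `q`. -/
theorem hill_solution_density_transform
    (c : ℝ) (hc : c ≠ 0)
    (p : ℝ → ℝ) (hp : Continuous p)
    (f : ℝ → ℝ) (hf : ContDiff ℝ (⊤ : ℕ∞) f) (hf' : ∀ x, 0 < deriv f x)
    (hflift : ∀ x, f (x + 2 * π) = f x + 2 * π)
    (q : ℝ → ℝ)
    (hq : ∀ x, q (f x) = (p x + c / 12 * schwarzian f x) / (deriv f x) ^ 2)
    (ψ : ℝ → ℝ)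
    (hψ : Differentiable ℝ ψ) (hψ' : Differentiable ℝ (deriv ψ))
    (hill : ∀ x, -(c / 6) * deriv (deriv ψ) x + p x * ψ x = 0)
    (φ : ℝ → ℝ)
    (hφ : ∀ x, φ (f x) = Real.sqrt (deriv f x) * ψ x) :
    (Differentiable ℝ φ ∧ Differentiable ℝ (deriv φ)) ∧
    ∀ y, -(c / 6) * deriv (deriv φ) y + q y * φ y = 0 := by
  have hsmooth1 : ContDiff ℝ (⊤ : ℕ∞) (deriv f) := (contDiff_infty_iff_deriv.1 hf).2
  have hsmooth2 : ContDiff ℝ (⊤ : ℕ∞) (deriv (deriv f)) :=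
    (contDiff_infty_iff_deriv.1 hsmooth1).2
  have hf1 : ∀ x, HasDerivAt f (deriv f x) x := fun x =>
    ((contDiff_infty_iff_deriv.1 hf).1 x).hasDerivAt
  have hf2 : ∀ x, HasDerivAt (deriv f) (deriv (deriv f) x) x := fun x =>
    ((contDiff_infty_iff_deriv.1 hsmooth1).1 x).hasDerivAt
  have hf3 : ∀ x, HasDerivAt (deriv (deriv f)) (deriv (deriv (deriv f)) x) x := fun x =>
    ((contDiff_infty_iff_deriv.1 hsmooth2).1 x).hasDerivAt
  have hmono : StrictMono f := strictMono_of_deriv_pos hf'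
  have hsurj : Function.Surjective f :=
    surjective_of_map_add_period hf.continuous hmono.monotone Real.two_pi_pos hflift
  have hs0 : ∀ x, √(deriv f x) ≠ 0 := fun x => (Real.sqrt_pos.2 (hf' x)).ne'
  have hsq : ∀ x, deriv f x = √(deriv f x) ^ 2 := fun x => (Real.sq_sqrt (hf' x).le).symm
  have hs : ∀ x, HasDerivAt (fun t => √(deriv f t))
      (deriv (deriv f) x / (2 * √(deriv f x))) x := fun x => (hf2 x).sqrt (hf' x).ne'
  have hφ1 : ∀ x, HasDerivAt φ (deriv (deriv f) x * ψ x / (2 * √(deriv f x) ^ 3)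
      + deriv ψ x / √(deriv f x)) (f x) := fun x => by
    have h := (hs x).mul (hψ x).hasDerivAt
    have h' : HasDerivAt (fun t => φ (f t)) _ x :=
      h.congr_of_eventuallyEq (Filter.Eventually.of_forall hφ)
    convert HasDerivAt.of_comp_strictMono hmono hsurj (hf1 x) (hf' x).ne' h' using 1
    have h0 := hs0 x
    have h2 := hsq x
    generalize √(deriv f x) = s at *
    rw [h2]
    field_simp
  have hφ2 : ∀ x, HasDerivAt (deriv φ)
      ((deriv (deriv ψ) x + schwarzian f x / 2 * ψ x) / √(deriv f x) ^ 3) (f x) := fun x => by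
    have h := (((hf3 x).mul (hψ x).hasDerivAt).div (((hs x).pow 3).const_mul 2)
      (mul_ne_zero two_ne_zero (pow_ne_zero 3 (hs0 x)))).add
      ((hψ' x).hasDerivAt.div (hs x) (hs0 x))
    have h' : HasDerivAt (fun t => deriv φ (f t)) _ x :=
      h.congr_of_eventuallyEq (Filter.Eventually.of_forall fun t => (hφ1 t).deriv)
    convert HasDerivAt.of_comp_strictMono hmono hsurj (hf1 x) (hf' x).ne' h' using 1
    have h0 := hs0 x
    have h2 := hsq x
    simp only [schwarzian, Pi.mul_apply, Pi.pow_apply]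
    generalize √(deriv f x) = s at *
    rw [h2]
    field_simp
    ring
  refine ⟨⟨fun y => ?_, fun y => ?_⟩, fun y => ?_⟩ <;> obtain ⟨x, rfl⟩ := hsurj y
  · exact (hφ1 x).differentiableAt
  · exact (hφ2 x).differentiableAt
  · rw [(hφ2 x).deriv, hq, hφ]
    have h0 := hs0 x
    have h2 := hsq x
    generalize √(deriv f x) = s at *
    rw [h2]
    field_simp
    linear_combination 144 * hill x
end

section
/- Fix m ∈ [0,1) and real numbers c and v. Define p : ℝ × ℝ → ℝ by p(x,τ) = v/3 − (c·K(m)²/(9π²))·(m+1) + (c·K(m)²/(3π²))·m·sn((K(m)/π)·(x − vτ)|m)². Then p is smooth, satisfies p(x + 2π, τ) = p(x, τ) for all x, τ, and solves the KdV equation ∂p/∂τ + 3·p·∂p/∂x − (c/12)·∂³p/∂x³ = 0 at every (x,τ) ∈ ℝ × ℝ. (The cnoidal wave is a 2π-periodic travelling-wave solution of KdV.) -/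
open Real

/-- Incomplete elliptic integral of the first kind `F(θ|m) = ∫₀^θ ds/√(1 - m sin²s)`. -/
noncomputable def ellF (m θ : ℝ) : ℝ :=
  ∫ s in (0:ℝ)..θ, 1 / Real.sqrt (1 - m * Real.sin s ^ 2)

/-- Complete elliptic integral of the first kind `K(m) = F(π/2|m)`. -/
noncomputable def ellK (m : ℝ) : ℝ := ellF m (π / 2)

/-- Complete elliptic integral of the second kind `E(m) = ∫₀^{π/2} √(1 - m sin²θ) dθ`. -/
noncomputable def ellE (m : ℝ) : ℝ :=
  ∫ θ in (0:ℝ)..(π / 2), Real.sqrt (1 - m * Real.sin θ ^ 2)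

/-- Jacobi amplitude: the inverse function of `θ ↦ F(θ|m)`. -/
noncomputable def am (m u : ℝ) : ℝ := Function.invFun (ellF m) u

/-- Jacobi elliptic sine. -/
noncomputable def sn (m u : ℝ) : ℝ := Real.sin (am m u)

/-- Jacobi elliptic cosine. -/
noncomputable def cn (m u : ℝ) : ℝ := Real.cos (am m u)

/-- Jacobi delta amplitude. -/
noncomputable def dn (m u : ℝ) : ℝ := Real.sqrt (1 - m * sn m u ^ 2)

lemma one_sub_mul_sin_sq_pos {m : ℝ} (hm : m ∈ Set.Ico (0 : ℝ) 1) (s : ℝ) :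
    0 < 1 - m * Real.sin s ^ 2 := by
  have h1 := Real.sin_sq_le_one s
  have h2 := mul_le_mul_of_nonneg_left h1 hm.1
  linarith [hm.2]

lemma continuous_ellF_integrand {m : ℝ} (hm : m ∈ Set.Ico (0 : ℝ) 1) :
    Continuous fun s : ℝ => 1 / Real.sqrt (1 - m * Real.sin s ^ 2) := by
  refine Continuous.div continuous_const (by fun_prop) fun s => ?_
  exact (Real.sqrt_pos.2 (one_sub_mul_sin_sq_pos hm s)).ne'

lemma hasDerivAt_ellF {m : ℝ} (hm : m ∈ Set.Ico (0 : ℝ) 1) (θ : ℝ) :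
    HasDerivAt (ellF m) (1 / Real.sqrt (1 - m * Real.sin θ ^ 2)) θ :=
  (continuous_ellF_integrand hm).integral_hasStrictDerivAt 0 θ |>.hasDerivAt

lemma continuous_ellF {m : ℝ} (hm : m ∈ Set.Ico (0 : ℝ) 1) : Continuous (ellF m) :=
  continuous_iff_continuousAt.2 fun θ => (hasDerivAt_ellF hm θ).continuousAt

lemma strictMono_ellF {m : ℝ} (hm : m ∈ Set.Ico (0 : ℝ) 1) : StrictMono (ellF m) := by
  refine strictMono_of_deriv_pos fun θ => ?_
  rw [(hasDerivAt_ellF hm θ).deriv]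
  exact one_div_pos.2 (Real.sqrt_pos.2 (one_sub_mul_sin_sq_pos hm θ))

@[simp] lemma ellF_zero (m : ℝ) : ellF m 0 = 0 := by simp [ellF]

lemma monotone_ellF_sub_id {m : ℝ} (hm : m ∈ Set.Ico (0 : ℝ) 1) :
    Monotone fun θ => ellF m θ - θ := by
  have h : ∀ θ, HasDerivAt (fun θ => ellF m θ - θ)
      (1 / Real.sqrt (1 - m * Real.sin θ ^ 2) - 1) θ :=
    fun θ => (hasDerivAt_ellF hm θ).sub (hasDerivAt_id θ)
  refine monotone_of_deriv_nonneg (fun θ => (h θ).differentiableAt) fun θ => ?_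
  rw [(h θ).deriv, sub_nonneg, one_le_div (Real.sqrt_pos.2 (one_sub_mul_sin_sq_pos hm θ))]
  refine Real.sqrt_le_one.2 ?_
  nlinarith [mul_nonneg hm.1 (sq_nonneg (Real.sin θ))]

lemma surjective_ellF {m : ℝ} (hm : m ∈ Set.Ico (0 : ℝ) 1) :
    Function.Surjective (ellF m) := by
  refine (continuous_ellF hm).surjective ?_ ?_
  · refine Filter.tendsto_atTop_mono' _ ?_ Filter.tendsto_id
    filter_upwards [Filter.eventually_ge_atTop 0] with θ hθ
    simpa using monotone_ellF_sub_id hm hθ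
  · refine Filter.tendsto_atBot_mono' _ ?_ Filter.tendsto_id
    filter_upwards [Filter.eventually_le_atBot 0] with θ hθ
    simpa using monotone_ellF_sub_id hm hθ

lemma ellF_am {m : ℝ} (hm : m ∈ Set.Ico (0 : ℝ) 1) (u : ℝ) : ellF m (am m u) = u :=
  Function.rightInverse_invFun (surjective_ellF hm) u

lemma am_ellF {m : ℝ} (hm : m ∈ Set.Ico (0 : ℝ) 1) (θ : ℝ) : am m (ellF m θ) = θ :=
  Function.leftInverse_invFun (strictMono_ellF hm).injective θ

lemma continuous_am {m : ℝ} (hm : m ∈ Set.Ico (0 : ℝ) 1) : Continuous (am m) := by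
  refine Monotone.continuous_of_surjective (fun a b hab => ?_) fun θ => ⟨_, am_ellF hm θ⟩
  rw [← (strictMono_ellF hm).le_iff_le, ellF_am hm, ellF_am hm]
  exact hab

lemma hasDerivAt_am {m : ℝ} (hm : m ∈ Set.Ico (0 : ℝ) 1) (u : ℝ) :
    HasDerivAt (am m) (dn m u) u := by
  have hpos := Real.sqrt_pos.2 (one_sub_mul_sin_sq_pos hm (am m u))
  have h := (hasDerivAt_ellF hm (am m u)).of_local_left_inverse
    (continuous_am hm).continuousAt (one_div_pos.2 hpos).ne'
    (Filter.Eventually.of_forall (ellF_am hm))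
  simpa [dn, sn] using h

lemma ellF_neg (m θ : ℝ) : ellF m (-θ) = -ellF m θ := by
  have h := intervalIntegral.integral_comp_neg (a := 0) (b := θ)
    (fun s : ℝ => 1 / Real.sqrt (1 - m * Real.sin s ^ 2))
  simp only [Real.sin_neg, neg_sq, neg_zero] at h
  rw [ellF, ellF, h, intervalIntegral.integral_symm]

lemma ellF_add_pi {m : ℝ} (hm : m ∈ Set.Ico (0 : ℝ) 1) (θ : ℝ) :
    ellF m (θ + π) = ellF m θ + 2 * ellK m := by
  have hper : Function.Periodic (fun s : ℝ => 1 / Real.sqrt (1 - m * Real.sin s ^ 2)) π := by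
    intro s
    simp [Real.sin_add_pi]
  have h_int : ∀ a b : ℝ, IntervalIntegrable
      (fun s : ℝ => 1 / Real.sqrt (1 - m * Real.sin s ^ 2)) MeasureTheory.volume a b :=
    fun a b => (continuous_ellF_integrand hm).intervalIntegrable a b
  have key : ∀ t, ellF m (t + π) = ellF m t + ellF m π := by
    intro t
    have h1 := hper.intervalIntegral_add_eq t 0
    rw [zero_add] at h1
    rw [ellF, ellF, ellF, ← h1, intervalIntegral.integral_add_adjacent_intervals] <;>
      exact h_int _ _
  have h2 := key (-(π / 2))
  rw [ellF_neg, show -(π / 2) + π = π / 2 by ring] at h2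
  rw [key, ellK]
  linarith

lemma am_add_two_mul_ellK {m : ℝ} (hm : m ∈ Set.Ico (0 : ℝ) 1) (u : ℝ) :
    am m (u + 2 * ellK m) = am m u + π := by
  apply (strictMono_ellF hm).injective
  rw [ellF_am hm, ellF_add_pi hm, ellF_am hm]

lemma sn_add_two_mul_ellK {m : ℝ} (hm : m ∈ Set.Ico (0 : ℝ) 1) (u : ℝ) :
    sn m (u + 2 * ellK m) = -sn m u := by
  rw [sn, am_add_two_mul_ellK hm, Real.sin_add_pi, sn]

lemma contDiff_am {m : ℝ} (hm : m ∈ Set.Ico (0 : ℝ) 1) : ContDiff ℝ (⊤ : ℕ∞) (am m) := by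
  refine contDiff_infty.2 fun n => ?_
  induction n with
  | zero => exact contDiff_zero.2 (continuous_am hm)
  | succ n ih =>
    push_cast
    refine contDiff_succ_iff_deriv.2
      ⟨fun u => (hasDerivAt_am hm u).differentiableAt, by simp, ?_⟩
    rw [show deriv (am m) = dn m from funext fun u => (hasDerivAt_am hm u).deriv]
    unfold dn sn
    refine ContDiff.sqrt ?_ fun u => (one_sub_mul_sin_sq_pos hm (am m u)).ne'
    exact contDiff_const.sub (contDiff_const.mul ((Real.contDiff_sin.comp ih).pow 2))

lemma contDiff_sn {m : ℝ} (hm : m ∈ Set.Ico (0 : ℝ) 1) : ContDiff ℝ (⊤ : ℕ∞) (sn m) :=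
  Real.contDiff_sin.comp (contDiff_am hm)

lemma sn_sq_add_cn_sq (m u : ℝ) : sn m u ^ 2 + cn m u ^ 2 = 1 :=
  Real.sin_sq_add_cos_sq _

lemma dn_sq {m : ℝ} (hm : m ∈ Set.Ico (0 : ℝ) 1) (u : ℝ) :
    dn m u ^ 2 = 1 - m * sn m u ^ 2 :=
  Real.sq_sqrt (one_sub_mul_sin_sq_pos hm (am m u)).le

lemma hasDerivAt_sn {m : ℝ} (hm : m ∈ Set.Ico (0 : ℝ) 1) (u : ℝ) :
    HasDerivAt (sn m) (cn m u * dn m u) u :=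
  (hasDerivAt_am hm u).sin

lemma hasDerivAt_cn {m : ℝ} (hm : m ∈ Set.Ico (0 : ℝ) 1) (u : ℝ) :
    HasDerivAt (cn m) (-sn m u * dn m u) u :=
  (hasDerivAt_am hm u).cos

lemma hasDerivAt_dn {m : ℝ} (hm : m ∈ Set.Ico (0 : ℝ) 1) (u : ℝ) :
    HasDerivAt (dn m) (-m * sn m u * cn m u) u := by
  have hpos : 0 < dn m u := Real.sqrt_pos.2 (one_sub_mul_sin_sq_pos hm (am m u))
  have h := ((((hasDerivAt_sn hm u).pow 2).const_mul m).const_sub 1).sqrt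
    (one_sub_mul_sin_sq_pos hm (am m u)).ne'
  refine h.congr_deriv ?_
  change _ / (2 * dn m u) = _
  field_simp
  push_cast
  ring

/-- The derivative of `sn²`. -/
lemma hasDerivAt_sn_sq {m : ℝ} (hm : m ∈ Set.Ico (0 : ℝ) 1) (u : ℝ) :
    HasDerivAt (fun u => sn m u ^ 2) (2 * (sn m u * cn m u * dn m u)) u :=
  ((hasDerivAt_sn hm u).pow 2).congr_deriv (by norm_num; ring)

lemma hasDerivAt_sn_mul_cn_mul_dn {m : ℝ} (hm : m ∈ Set.Ico (0 : ℝ) 1) (u : ℝ) :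
    HasDerivAt (fun u => sn m u * cn m u * dn m u)
      (1 - 2 * (1 + m) * sn m u ^ 2 + 3 * m * (sn m u ^ 2) ^ 2) u := by
  refine (((hasDerivAt_sn hm u).mul (hasDerivAt_cn hm u)).mul
    (hasDerivAt_dn hm u)).congr_deriv ?_
  simp only [Pi.mul_apply]
  linear_combination (cn m u ^ 2 - sn m u ^ 2) * dn_sq hm u +
    (1 - 2 * m * sn m u ^ 2) * sn_sq_add_cn_sq m u

/-- **The cnoidal wave is a smooth `2π`-periodic travelling-wave solution of KdV.**
For `m ∈ [0,1)` and real `c, v`, the cnoidal profile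
`p(x,τ) = v/3 - (cK(m)²/(9π²))(m+1) + (cK(m)²/(3π²)) m sn((K(m)/π)(x - vτ)|m)²`
is smooth, `2π`-periodic in `x`, and solves `∂_τ p + 3 p ∂_x p - (c/12) ∂_x³ p = 0`. -/
theorem cnoidal_wave_solves_kdv
    (m c v : ℝ) (hm : m ∈ Set.Ico (0:ℝ) 1) :
    let p : ℝ → ℝ → ℝ := fun x τ =>
      v / 3 - c * ellK m ^ 2 / (9 * π ^ 2) * (m + 1) +
        c * ellK m ^ 2 / (3 * π ^ 2) * m * sn m (ellK m / π * (x - v * τ)) ^ 2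
    ContDiff ℝ (⊤ : ℕ∞) (fun q : ℝ × ℝ => p q.1 q.2) ∧
    (∀ x τ : ℝ, p (x + 2 * π) τ = p x τ) ∧
    (∀ x τ : ℝ,
      deriv (fun t => p x t) τ + 3 * p x τ * deriv (fun y => p y τ) x -
        c / 12 * iteratedDeriv 3 (fun y => p y τ) x = 0) := by
  intro p
  refine ⟨?_, ?_, ?_⟩
  · refine contDiff_const.add (contDiff_const.mul (((contDiff_sn hm).comp ?_).pow 2))
    fun_prop
  · intro x τ
    have hu : ellK m / π * (x + 2 * π - v * τ) =
        ellK m / π * (x - v * τ) + 2 * ellK m := by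
      field_simp
      ring
    simp only [p, hu, sn_add_two_mul_ellK hm, neg_sq]
  · intro x τ
    set κ := ellK m / π with hκ
    set A := v / 3 - c * ellK m ^ 2 / (9 * π ^ 2) * (m + 1) with hA
    set B := c * ellK m ^ 2 / (3 * π ^ 2) * m with hB
    have hA' : A = v / 3 - c * κ ^ 2 / 9 * (m + 1) := by rw [hA, hκ]; field_simp
    have hB' : B = c * κ ^ 2 / 3 * m := by rw [hB, hκ]; field_simp
    have hx : ∀ y, HasDerivAt (fun y => κ * (y - v * τ)) κ y := fun y => by
      simpa using ((hasDerivAt_id y).sub_const (v * τ)).const_mul κ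
    have ht : HasDerivAt (fun t => κ * (x - v * t)) (-(κ * v)) τ := by
      simpa using (((hasDerivAt_id τ).const_mul v).const_sub x).const_mul κ
    let S : ℝ → ℝ := fun u => sn m u ^ 2
    let Q : ℝ → ℝ := fun u => sn m u * cn m u * dn m u
    have hpt : deriv (fun t => p x t) τ =
        B * (2 * Q (κ * (x - v * τ)) * -(κ * v)) :=
      ((((hasDerivAt_sn_sq hm _).comp τ ht).const_mul B).const_add A).deriv
    have hpx : deriv (fun y => p y τ) = fun y => B * (2 * Q (κ * (y - v * τ)) * κ) :=
      funext fun y =>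
        ((((hasDerivAt_sn_sq hm _).comp y (hx y)).const_mul B).const_add A).deriv
    have hpxx : deriv (fun y => B * (2 * Q (κ * (y - v * τ)) * κ)) = fun y =>
        B * (2 * ((1 - 2 * (1 + m) * S (κ * (y - v * τ)) +
          3 * m * S (κ * (y - v * τ)) ^ 2) * κ) * κ) :=
      funext fun y => (((((hasDerivAt_sn_mul_cn_mul_dn hm _).comp y
        (hx y)).const_mul 2).mul_const κ).const_mul B).deriv
    have hpxxx : deriv (fun y => B * (2 * ((1 - 2 * (1 + m) * S (κ * (y - v * τ)) +
          3 * m * S (κ * (y - v * τ)) ^ 2) * κ) * κ)) x =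
        B * (2 * ((-(2 * (1 + m)) + 6 * m * S (κ * (x - v * τ))) *
          (2 * Q (κ * (x - v * τ)) * κ) * κ) * κ) := by
      have hS : HasDerivAt (fun y => S (κ * (y - v * τ))) (2 * Q (κ * (x - v * τ)) * κ) x :=
        (hasDerivAt_sn_sq hm _).comp x (hx x)
      refine HasDerivAt.deriv (((((((hS.const_mul (2 * (1 + m))).const_sub 1).add
        ((hS.pow 2).const_mul (3 * m))).mul_const κ).const_mul 2).mul_const κ).const_mul
          B |>.congr_deriv ?_)
      push_cast
      ring
    rw [iteratedDeriv_succ, iteratedDeriv_succ, iteratedDeriv_one, hpt, hpx, hpxx, hpxxx]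
    change B * (2 * Q (κ * (x - v * τ)) * -(κ * v)) +
      3 * (A + B * S (κ * (x - v * τ))) * (B * (2 * Q (κ * (x - v * τ)) * κ)) - _ = 0
    rw [hA', hB']
    ring
end
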